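/- Assume Assumption 3.3 holds for v, let b > 0 and c₁ > c₂ > 0, and assume L_{c₂}(t) = (b + c₂t)²/(2v(t)) has a minimizer t_F ∈ (0,∞) such that L_{c₂} is strictly decreasing on (0, t_F) and strictly increasing on (t_F, ∞). Set c₁^F = sup_{s ∈ (0,t_F)} k(s,t_F)/s and suppose c₁ < c₁^F. Suppose (s*, t*) with t* > t₀ and s* ∈ (0, t*) is optimal for the lower bound, i.e., sup_{s∈(0,t*)} Υ(s,t*) = Υ(s*,t*) and inf_{t>t₀} sup_{s∈(0,t)} Υ(s,t) = Υ(s*,t*). Then k(s*, t*) ≥ c₁ s*. -/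

import Mathlib

open Set Matrix
noncomputable section

/-- Γ(s,t) = (v(t) − v(t−s) + v(s))/2. -/
def Gam (v : ℝ → ℝ) (s t : ℝ) : ℝ := (v t - v (t - s) + v s) / 2

/-- k(s,t) = Γ(s,t)(b + c₂t)/v(t). -/
def kvf (b c₂ : ℝ) (v : ℝ → ℝ) (s t : ℝ) : ℝ := Gam v s t * (b + c₂ * t) / v t

/-- The covariance matrix Σ(t−s, t): diagonal entries v(t), v(t−s), off-diagonal entries
Γ(t−s,t) = (v(t) − v(s) + v(t−s))/2. -/
def SigTS (v : ℝ → ℝ) (s t : ℝ) : Matrix (Fin 2) (Fin 2) ℝ :=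
  !![v t, (v t - v s + v (t - s)) / 2; (v t - v s + v (t - s)) / 2, v (t - s)]

/-- Λ(y,z) = ½ (y,z) Σ(t−s,t)⁻¹ (y,z)ᵀ. -/
def Lam (v : ℝ → ℝ) (s t y z : ℝ) : ℝ :=
  (1 / 2) * (![y, z] ⬝ᵥ ((SigTS v s t)⁻¹ *ᵥ ![y, z]))

/-- Υ(s,t): Λ(b+c₂t, b+c₂t−c₁s) if k(s,t) > c₁s, else (b+c₂t)²/(2v(t)). -/
def Ups (b c₁ c₂ : ℝ) (v : ℝ → ℝ) (s t : ℝ) : ℝ :=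
  if c₁ * s < kvf b c₂ v s t then Lam v s t (b + c₂ * t) (b + c₂ * t - c₁ * s)
  else (b + c₂ * t) ^ 2 / (2 * v t)

lemma Lam_eq (v : ℝ → ℝ) (s t y x : ℝ) (hv : 0 < v t)
    (hD : 0 < v t * v (t - s) - ((v t - v s + v (t - s)) / 2) ^ 2) :
    Lam v s t y (y - x) = y ^ 2 / (2 * v t) + (Gam v s t * y / v t - x) ^ 2 * v t /
      (2 * (v t * v (t - s) - ((v t - v s + v (t - s)) / 2) ^ 2)) := by
  unfold Lam SigTS Gam
  have h1 : v t ≠ 0 := hv.ne'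
  have e : v t * v (t - s) - (v t - v s + v (t - s)) / 2 * ((v t - v s + v (t - s)) / 2)
    = v t * v (t - s) - ((v t - v s + v (t - s)) / 2) ^ 2 := by ring
  rw [Matrix.inv_def, Matrix.det_fin_two_of, Matrix.adjugate_fin_two_of, Ring.inverse_eq_inv', e]
  obtain ⟨D, hDe⟩ : ∃ D, D = v t * v (t - s) - ((v t - v s + v (t - s)) / 2) ^ 2 := ⟨_, rfl⟩
  rw [← hDe] at hD ⊢
  have h2 : D ≠ 0 := hD.ne'
  obtain ⟨g, hg⟩ : ∃ g, g = (v t - v s + v (t - s)) / 2 := ⟨_, rfl⟩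
  have hG : (v t - v (t - s) + v s) / 2 = v t - g := by rw [hg]; ring
  rw [hG, ← hg]
  rw [← hg] at hDe
  have hq' : v (t - s) = (D + g ^ 2) / v t := by field_simp; linarith
  rw [hq', Matrix.smul_mulVec, dotProduct_smul]
  simp only [dotProduct, Fin.sum_univ_two, Matrix.mulVec, smul_eq_mul, Matrix.cons_val_zero,
    Matrix.cons_val_one, Matrix.of_apply]
  simp
  field_simp
  ring

lemma D_lower (f : ℝ → ℝ) (hf0 : f 0 = 0) (hmono : StrictMonoOn f (Ici 0))
    (hconc : StrictConcaveOn ℝ (Ici 0) f) (δ T0 T : ℝ) (hδ : 0 < δ) (hT0 : δ < T0) (hT : T0 ≤ T) :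
    ∃ c > 0, ∀ t, T0 ≤ t → t ≤ T → ∀ s, 0 < s → s ≤ t - δ →
      c * s ^ 2 ≤ f t ^ 2 * f (t - s) ^ 2 - ((f t ^ 2 - f s ^ 2 + f (t - s) ^ 2) / 2) ^ 2 := by
  have conc : ∀ x y w : ℝ, 0 ≤ x → 0 ≤ y → 0 ≤ w → w ≤ 1 →
      (1 - w) * f x + w * f y ≤ f ((1 - w) * x + w * y) := by
    intro x y w hx hy hw hw1
    have := hconc.concaveOn.2 (mem_Ici.2 hx) (mem_Ici.2 hy) (sub_nonneg.2 hw1) hw (by ring)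
    simpa using this
  have mono : ∀ x y : ℝ, 0 ≤ x → x ≤ y → f x ≤ f y := by
    intro x y hx hxy
    exact hmono.monotoneOn (mem_Ici.2 hx) (mem_Ici.2 (hx.trans hxy)) hxy
  have pos : ∀ x : ℝ, 0 < x → 0 < f x := by
    intro x hx
    have := hmono (mem_Ici.2 le_rfl) (mem_Ici.2 hx.le) hx
    rwa [hf0] at this
  have hT0p : 0 < T0 := hδ.trans hT0
  have hTp : 0 < T := hT0p.trans_le hT
  have hη : 0 < f δ + f (T0 - δ) - f T0 := by
    have hc2 := hconc.2
    have h1 := @hc2 0 (mem_Ici.2 le_rfl) T0 (mem_Ici.2 hT0p.le) hT0p.ne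
      (1 - δ / T0) (δ / T0) (by rw [sub_pos, div_lt_one hT0p]; exact hT0)
      (by positivity) (by ring)
    have h2 := @hc2 0 (mem_Ici.2 le_rfl) T0 (mem_Ici.2 hT0p.le) hT0p.ne
      (δ / T0) (1 - δ / T0) (by positivity) (by rw [sub_pos, div_lt_one hT0p]; exact hT0)
       (by ring)
    simp only [smul_eq_mul, hf0, mul_zero, zero_add] at h1 h2
    rw [show δ / T0 * T0 = δ by field_simp] at h1
    rw [show (1 - δ / T0) * T0 = T0 - δ by field_simp] at h2
    linarith
  obtain ⟨η, hηe⟩ : ∃ η, η = f δ + f (T0 - δ) - f T0 := ⟨_, rfl⟩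
  rw [← hηe] at hη
  have hfT := pos T hTp
  have hfT0 := pos T0 hT0p
  have hfδ := pos δ hδ
  refine ⟨(f T / T) * f T0 * (η / T) * f δ / 4, by positivity, ?_⟩
  intro t ht0 htT s hs hst
  have htp : 0 < t := hT0p.trans_le ht0
  have htd : 0 < t - δ := by linarith
  have hp : s * (f T / T) ≤ f s := by
    have := conc 0 T (s / T) le_rfl hTp.le (by positivity) (by rw [div_le_one hTp]; linarith)
    rw [hf0, mul_zero, zero_add, zero_add, show s / T * T = s by field_simp] at this
    calc _ = s / T * f T := by ring
      _ ≤ _ := this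
  have hq : f δ ≤ f (t - s) := mono _ _ hδ.le (by linarith)
  have ha : f T0 ≤ f t := mono _ _ hT0p.le ht0
  have hqa : f (t - s) ≤ f t := mono _ _ (by linarith) (by linarith)
  have hpa : f s ≤ f t := mono _ _ hs.le (by linarith)
  have hfs := pos s hs
  have h4 : f (T0 - δ) + f t ≤ f T0 + f (t - δ) := by
    have hx : 0 < t - T0 + δ := by linarith
    have hθ : δ / (t - T0 + δ) ≤ 1 := by rw [div_le_one hx]; linarith
    have h1 := conc (T0 - δ) t (δ / (t - T0 + δ)) (by linarith) htp.le (by positivity) hθ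
    have h2 := conc t (T0 - δ) (δ / (t - T0 + δ)) htp.le (by linarith) (by positivity) hθ
    rw [show (1 - δ / (t - T0 + δ)) * (T0 - δ) + δ / (t - T0 + δ) * t = T0 by
      field_simp; ring] at h1
    rw [show (1 - δ / (t - T0 + δ)) * t + δ / (t - T0 + δ) * (T0 - δ) = t - δ by
      field_simp; ring] at h2
    linarith
  have h5 : s * (η / T) ≤ f (t - s) - f t + f s := by
    have hμ0 : 0 ≤ s / (t - δ) := by positivity
    have hμ : s / (t - δ) ≤ 1 := by rw [div_le_one htd]; linarith
    have h1 := conc 0 (t - δ) (s / (t - δ)) le_rfl htd.le hμ0 hμ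
    have h2 := conc t δ (s / (t - δ)) htp.le hδ.le hμ0 hμ
    rw [hf0, mul_zero, zero_add, zero_add,
      show s / (t - δ) * (t - δ) = s by field_simp] at h1
    rw [show (1 - s / (t - δ)) * t + s / (t - δ) * δ = t - s by field_simp; ring] at h2
    have h3 : s / (t - δ) * η ≤ s / (t - δ) * (f (t - δ) + f δ - f t) :=
      mul_le_mul_of_nonneg_left (by linarith) hμ0
    have h6 : s * (η / T) ≤ s / (t - δ) * η := by
      rw [show s * (η / T) = s / T * η by ring]
      gcongr
      linarith
    linarith
  have key : (s * (f T / T)) * f T0 * (s * (η / T)) * f δ ≤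
      (f t + f s - f (t - s)) * (f t + f s + f (t - s)) * (f (t - s) - f t + f s) *
        (f (t - s) + f t - f s) := by
    have e1 : s * (f T / T) ≤ f t + f s - f (t - s) := by linarith
    have e2 : f T0 ≤ f t + f s + f (t - s) := by linarith
    have e4 : f δ ≤ f (t - s) + f t - f s := by linarith
    have p1 : 0 < s * (f T / T) := by positivity
    have p2 : 0 < s * (η / T) := by positivity
    have q1 := p1.trans_le e1
    have q2 := hfT0.trans_le e2
    have q3 := p2.trans_le h5
    gcongr
  nlinarith [key]

lemma v_C2 (v : ℝ → ℝ) (hvpos : ∀ u > 0, 0 < v u)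
    (hC2 : ContDiffOn ℝ 2 (fun u => Real.sqrt (v u)) (Ici 0)) : ContDiffOn ℝ 2 v (Ioi 0) := by
  have h := (hC2.mono Ioi_subset_Ici_self).pow 2
  refine h.congr ?_
  intro x hx
  rw [Real.sq_sqrt (hvpos x hx).le]

lemma incr (v : ℝ → ℝ) (hv : ContDiffOn ℝ 2 v (Ioi 0)) (m T : ℝ) (hm : 0 < m) :
    ∃ K ≥ 0, ∀ x ∈ Icc m T, ∀ y ∈ Icc m T, ∀ h, x + h ∈ Icc m T → y + h ∈ Icc m T →
      |(v (x + h) - v x) - (v (y + h) - v y)| ≤ K * |h| * |x - y| := by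
  have hd : ContDiffOn ℝ 1 (deriv v) (Ioi 0) := by
    have := (contDiffOn_succ_iff_deriv_of_isOpen (n := 1) isOpen_Ioi).1 (by simpa [one_add_one_eq_two] using hv)
    exact this.2.2
  have hdd : ContinuousOn (deriv (deriv v)) (Ioi 0) :=
    hd.continuousOn_deriv_of_isOpen isOpen_Ioi le_rfl
  have hsub : Icc m T ⊆ Ioi 0 := fun x hx => hm.trans_le hx.1
  obtain ⟨K, hK⟩ := (isCompact_Icc (a := m) (b := T)).exists_bound_of_continuousOn (hdd.mono hsub)
  have dv : ∀ x, 0 < x → DifferentiableAt ℝ v x := fun x hx =>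
    (hv.differentiableOn (by norm_num)).differentiableAt (Ioi_mem_nhds hx)
  have ddv : ∀ x, 0 < x → DifferentiableAt ℝ (deriv v) x := fun x hx =>
    (hd.differentiableOn (by norm_num)).differentiableAt (Ioi_mem_nhds hx)
  refine ⟨max K 0, le_max_right _ _, ?_⟩
  intro x hx y hy h hxh hyh
  have lip : ∀ z ∈ uIcc y x, z ∈ Icc m T ∧ z + h ∈ Icc m T := by
    intro z hz
    rw [mem_uIcc] at hz
    simp only [mem_Icc] at *
    rcases hz with hz | hz <;> refine ⟨⟨?_, ?_⟩, ⟨?_, ?_⟩⟩ <;> linarith [hz.1, hz.2, hx.1, hx.2, hy.1, hy.2, hxh.1, hxh.2, hyh.1, hyh.2]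
  have hder : ∀ z ∈ uIcc y x, HasDerivWithinAt (fun z => v (z + h) - v z)
      (deriv v (z + h) - deriv v z) (uIcc y x) z := by
    intro z hz
    obtain ⟨h1, h2⟩ := lip z hz
    have a := (dv _ (hsub h2)).hasDerivAt.comp_add_const z h
    exact (a.sub (dv _ (hsub h1)).hasDerivAt).hasDerivWithinAt
  have hb : ∀ z ∈ uIcc y x, ‖deriv v (z + h) - deriv v z‖ ≤ max K 0 * |h| := by
    intro z hz
    obtain ⟨h1, h2⟩ := lip z hz
    have := (convex_Icc m T).norm_image_sub_le_of_norm_deriv_le (f := deriv v) (C := max K 0)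
      (fun w hw => ddv w (hsub hw)) (fun w hw => (hK w hw).trans (le_max_left _ _)) h1 h2
    simpa using this
  have := (convex_uIcc y x).norm_image_sub_le_of_norm_hasDerivWithin_le hder hb
    left_mem_uIcc right_mem_uIcc
  simpa using this

set_option maxHeartbeats 1600000 in
lemma local_bound (b c₁ c₂ : ℝ) (hb : 0 < b) (hc₂ : 0 < c₂) (hc : c₂ < c₁)
    (v : ℝ → ℝ) (hv0 : v 0 = 0) (hvpos : ∀ u > 0, 0 < v u)
    (hC2 : ContDiffOn ℝ 2 (fun u => Real.sqrt (v u)) (Ici 0))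
    (hmono : StrictMonoOn (fun u => Real.sqrt (v u)) (Ici 0))
    (hconc : StrictConcaveOn ℝ (Ici 0) (fun u => Real.sqrt (v u)))
    (ts : ℝ) (hts : b / (c₁ - c₂) < ts)
    (hk : ∀ s ∈ Ioo (0 : ℝ) ts, kvf b c₂ v s ts ≤ c₁ * s) :
    ∃ C ≥ 0, ∃ ε > 0, ∀ t, |t - ts| < ε → b / (c₁ - c₂) < t ∧ ∀ s ∈ Ioo (0 : ℝ) t,
      Ups b c₁ c₂ v s t ≤ (b + c₂ * t) ^ 2 / (2 * v t) + C * (t - ts) ^ 2 := by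
  have hcc : 0 < c₁ - c₂ := sub_pos.2 hc
  have hc₁ : 0 < c₁ := hc₂.trans hc
  obtain ⟨t0, ht0⟩ : ∃ t0, t0 = b / (c₁ - c₂) := ⟨_, rfl⟩
  rw [← ht0] at hts ⊢
  have ht0b : (c₁ - c₂) * t0 = b := by rw [ht0]; field_simp
  have ht0p : 0 < t0 := by rw [ht0]; positivity
  obtain ⟨T0, hT0⟩ : ∃ T0, T0 = (t0 + ts) / 2 := ⟨_, rfl⟩
  obtain ⟨δ, hδe⟩ : ∃ δ, δ = (c₁ - c₂) * (T0 - t0) / c₁ := ⟨_, rfl⟩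
  have hδm : c₁ * δ = (c₁ - c₂) * (T0 - t0) := by rw [hδe]; field_simp
  have hT0t : 0 < T0 - t0 := by linarith
  have hδ : 0 < δ := by rw [hδe]; positivity
  have hδT : δ < T0 := by
    have : 0 < c₁ * (T0 - δ) := by nlinarith
    have := pos_of_mul_pos_right this hc₁.le
    linarith
  have htsp : 0 < ts := ht0p.trans hts
  have hv2 := v_C2 v hvpos hC2
  obtain ⟨c, hcpos, hD⟩ := D_lower _ (by simp [hv0]) hmono hconc δ T0 (ts + 1) hδ hδT (by linarith)
  obtain ⟨K, hK0, hK⟩ := incr v hv2 (δ / 2) (ts + 1) (by linarith)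
  have vs := hvpos ts htsp
  have hA : DifferentiableAt ℝ (fun t => (b + c₂ * t) / v t) ts := by
    have : DifferentiableAt ℝ v ts :=
      (hv2.differentiableOn (by norm_num)).differentiableAt (Ioi_mem_nhds htsp)
    exact DifferentiableAt.div (by fun_prop) this vs.ne'
  obtain ⟨C1, hC1p, hC1⟩ := hA.hasDerivAt.isBigO_sub.exists_pos
  rw [Asymptotics.isBigOWith_iff, Metric.eventually_nhds_iff] at hC1
  obtain ⟨ε1, hε1, hAb⟩ := hC1
  obtain ⟨As, hAs⟩ : ∃ As, As = (b + c₂ * ts) / v ts := ⟨_, rfl⟩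
  have hAsp : 0 < As := by rw [hAs]; positivity
  obtain ⟨M, hM⟩ : ∃ M, M = c₁ * (C1 / As) + (As + C1) * K / 2 := ⟨_, rfl⟩
  have hM0 : 0 ≤ M := by rw [hM]; positivity
  have vT := hvpos (ts + 1) (by linarith)
  refine ⟨M ^ 2 * v (ts + 1) / (2 * c), by positivity, min ε1 (min 1 (min (δ / 2) ((ts - t0) / 2))),
    by refine lt_min hε1 (lt_min one_pos (lt_min ?_ ?_)) <;> linarith, ?_⟩
  intro t ht
  simp only [lt_min_iff] at ht
  obtain ⟨h1, h2, h3, h4⟩ := ht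
  have h2' := abs_lt.1 h2
  have h3' := abs_lt.1 h3
  have h4' := abs_lt.1 h4
  have htT0 : T0 < t := by linarith [h4'.1]
  refine ⟨by linarith, ?_⟩
  rintro s ⟨hs, hst⟩
  have htp : 0 < t := by linarith
  have vt := hvpos t htp
  have vmono : ∀ x y, 0 ≤ x → x ≤ y → 0 < y → v x ≤ v y := by
    intro x y hx hxy hy
    have h := hmono.monotoneOn (mem_Ici.2 hx) (mem_Ici.2 (hx.trans hxy)) hxy
    exact (Real.sqrt_le_sqrt_iff (hvpos y hy).le).1 h
  unfold Ups
  split_ifs with hks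
  swap
  · have : 0 ≤ M ^ 2 * v (ts + 1) / (2 * c) * (t - ts) ^ 2 := by positivity
    linarith
  have hsδ : s ≤ t - δ := by
    by_contra hcon
    push Not at hcon
    have hG : Gam v s t ≤ v t := by
      unfold Gam
      have := vmono s t hs.le hst.le htp
      have := hvpos (t - s) (by linarith)
      linarith
    have hk2 : kvf b c₂ v s t ≤ b + c₂ * t := by
      unfold kvf
      rw [div_le_iff₀ vt, mul_comm]
      exact mul_le_mul_of_nonneg_left hG (by positivity)
    have : c₁ * (t - δ) < c₁ * s := by gcongr
    nlinarith
  have hD' := hD t htT0.le (by linarith) s hs hsδ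
  rw [Real.sq_sqrt vt.le, Real.sq_sqrt (hvpos s hs).le, Real.sq_sqrt (hvpos (t - s) (by linarith)).le]
    at hD'
  have hcs : 0 < c * s ^ 2 := by positivity
  have hDp := hcs.trans_le hD'
  rw [Lam_eq v s t _ _ vt hDp]
  have hkM : kvf b c₂ v s t - c₁ * s ≤ M * s * |t - ts| := by
    have hk1 := hk s ⟨hs, by linarith⟩
    have hA1 := hAb (by rw [Real.dist_eq]; exact h1)
    rw [Real.norm_eq_abs, Real.norm_eq_abs, ← hAs] at hA1
    obtain ⟨A, hAe⟩ : ∃ A, A = (b + c₂ * t) / v t := ⟨_, rfl⟩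
    rw [← hAe] at hA1
    have hAp : 0 < A := by rw [hAe]; positivity
    have hA2 : A - As ≤ C1 * |t - ts| := (le_abs_self _).trans hA1
    have hA3 : A ≤ As + C1 := by nlinarith
    have hke : kvf b c₂ v s t = Gam v s t * A := by rw [hAe]; unfold kvf; ring
    have hkse : kvf b c₂ v s ts = Gam v s ts * As := by rw [hAs]; unfold kvf; ring
    have hinc := hK ts ⟨by linarith, by linarith⟩ (ts - s) ⟨by linarith, by linarith⟩ (t - ts)
      ⟨by linarith, by linarith⟩ ⟨by linarith, by linarith⟩
    rw [show ts + (t - ts) = t by ring, show ts - s + (t - ts) = t - s by ring,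
      show ts - (ts - s) = s by ring, abs_of_pos hs] at hinc
    have hinc2 := (le_abs_self _).trans hinc
    have hGd : Gam v s t ≤ Gam v s ts + K * |t - ts| * s / 2 := by
      unfold Gam; linarith
    have hGs : Gam v s ts ≤ c₁ * s / As := by
      rw [le_div_iff₀ hAsp, ← hkse]; exact hk1
    calc kvf b c₂ v s t - c₁ * s = Gam v s t * A - c₁ * s := by rw [hke]
      _ ≤ (c₁ * s / As + K * |t - ts| * s / 2) * A - c₁ * s := by
        have : Gam v s t ≤ c₁ * s / As + K * |t - ts| * s / 2 := by linarith
        have := mul_le_mul_of_nonneg_right this hAp.le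
        linarith
      _ = c₁ * s / As * (A - As) + K * |t - ts| * s / 2 * A := by field_simp; ring
      _ ≤ c₁ * s / As * (C1 * |t - ts|) + K * |t - ts| * s / 2 * (As + C1) := by gcongr
      _ = M * s * |t - ts| := by rw [hM]; ring
  have hx : 0 ≤ kvf b c₂ v s t - c₁ * s := by linarith
  have hsq : (kvf b c₂ v s t - c₁ * s) ^ 2 ≤ (M * s * |t - ts|) ^ 2 := by gcongr
  have vle : v t ≤ v (ts + 1) := vmono _ _ htp.le (by linarith) (by linarith)
  have fin : (kvf b c₂ v s t - c₁ * s) ^ 2 * v t /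
      (2 * (v t * v (t - s) - ((v t - v s + v (t - s)) / 2) ^ 2)) ≤
      (M * s * |t - ts|) ^ 2 * v (ts + 1) / (2 * (c * s ^ 2)) := by gcongr
  have e : (M * s * |t - ts|) ^ 2 * v (ts + 1) / (2 * (c * s ^ 2)) =
      M ^ 2 * v (ts + 1) / (2 * c) * (t - ts) ^ 2 := by
    rw [mul_pow, sq_abs]; field_simp
  rw [e] at fin
  unfold kvf at fin
  linarith

lemma slope_aux (q qs qF l ls lF g gs gF w : ℝ) (hls : 0 < ls) (hlF : 0 < lF) (hgs : 0 < gs)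
    (hgF : 0 < gF) (hw : 0 < w) (hw1 : w ≤ 1) (hl : l = (1 - w) * ls + w * lF)
    (hg : (1 - w) * gs + w * gF ≤ g) (hq : q = l / g) (hqs : qs = ls / gs) (hqF : qF = lF / gF)
    (hlt : qF < qs) :
    q ^ 2 / 2 ≤ qs ^ 2 / 2 - w * (qs * gF * (qs - qF) / (gs + gF) / 2) := by
  have hqs0 : 0 < qs := by rw [hqs]; positivity
  have hw1' : 0 ≤ 1 - w := by linarith
  obtain ⟨g1, hg1⟩ : ∃ g1, g1 = (1 - w) * gs + w * gF := ⟨_, rfl⟩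
  have hg1p : 0 < g1 := by rw [hg1]; positivity
  have hlp : 0 < l := by rw [hl]; positivity
  have hgp : 0 < g := by linarith
  have hqp : 0 < q := by rw [hq]; positivity
  have h1 : q ≤ l / g1 := by rw [hq]; gcongr; linarith
  have hls' : ls = qs * gs := by rw [hqs]; field_simp
  have hlF' : lF = qF * gF := by rw [hqF]; field_simp
  have h2 : l / g1 = qs - w * gF * (qs - qF) / g1 := by
    rw [hl, hls', hlF']
    have : g1 ≠ 0 := hg1p.ne'
    field_simp
    rw [hg1]; ring
  have hd : 0 < qs - qF := by linarith
  have h3 : w * gF * (qs - qF) / (gs + gF) ≤ w * gF * (qs - qF) / g1 := by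
    gcongr
    rw [hg1]; nlinarith
  have h4 : 0 < w * gF * (qs - qF) / (gs + gF) := by positivity
  have h5 : w * (qs * gF * (qs - qF) / (gs + gF) / 2) =
    w * gF * (qs - qF) / (gs + gF) * qs / 2 := by ring
  rw [h5]
  nlinarith

/-- Lemma 3.9: under Assumption 3.3, if c₁ < c₁^F (i.e. c₁ < sup_{s∈(0,t_F)} k(s,t_F)/s,
equivalently there is s ∈ (0,t_F) with c₁s < k(s,t_F)), then any optimizing pair (s*,t*)
of the lower bound inf_{t>t₀} sup_{s∈(0,t)} Υ(s,t) satisfies k(s*,t*) ≥ c₁s*. -/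
theorem lemma_3_9 (b c₁ c₂ : ℝ) (hb : 0 < b) (hc₂ : 0 < c₂) (hc : c₂ < c₁)
    (v : ℝ → ℝ) (hv0 : v 0 = 0) (hvpos : ∀ u > 0, 0 < v u)
    (hvcont : ContinuousOn v (Ici 0))
    (hC2 : ContDiffOn ℝ 2 (fun u => Real.sqrt (v u)) (Ici 0))
    (hmono : StrictMonoOn (fun u => Real.sqrt (v u)) (Ici 0))
    (hconc : StrictConcaveOn ℝ (Ici 0) (fun u => Real.sqrt (v u)))
    (hPD : ∀ s t : ℝ, 0 < s → s < t → (SigTS v s t).PosDef)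
    (tF : ℝ) (htF0 : 0 < tF)
    (hminF : ∀ t ∈ Ioi (0 : ℝ),
      (b + c₂ * tF) ^ 2 / (2 * v tF) ≤ (b + c₂ * t) ^ 2 / (2 * v t))
    (hdec : StrictAntiOn (fun t => (b + c₂ * t) ^ 2 / (2 * v t)) (Ioo 0 tF))
    (hinc : StrictMonoOn (fun t => (b + c₂ * t) ^ 2 / (2 * v t)) (Ioi tF))
    (hc1F : ∃ s ∈ Ioo (0 : ℝ) tF, c₁ * s < kvf b c₂ v s tF)
    (sstar tstar : ℝ) (htstar : b / (c₁ - c₂) < tstar)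
    (hsstar : sstar ∈ Ioo (0 : ℝ) tstar)
    (hsupopt : sSup ((fun s => Ups b c₁ c₂ v s tstar) '' Ioo (0 : ℝ) tstar) =
      Ups b c₁ c₂ v sstar tstar)
    (hinfopt : sInf ((fun t => sSup ((fun s => Ups b c₁ c₂ v s t) '' Ioo (0 : ℝ) t)) ''
        Ioi (b / (c₁ - c₂))) = Ups b c₁ c₂ v sstar tstar) :
    c₁ * sstar ≤ kvf b c₂ v sstar tstar := by
  by_contra hcon
  push Not at hcon
  have hcc : 0 < c₁ - c₂ := sub_pos.2 hc
  have ht0p : 0 < b / (c₁ - c₂) := by positivity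
  have htsp : 0 < tstar := ht0p.trans htstar
  have Dpos : ∀ s t : ℝ, 0 < s → s < t →
      0 < v t * v (t - s) - ((v t - v s + v (t - s)) / 2) ^ 2 := by
    intro s t hs hst
    have := (hPD s t hs hst).det_pos
    unfold SigTS at this
    rw [Matrix.det_fin_two_of] at this
    linarith
  have Ups_ge : ∀ s t : ℝ, 0 < s → s < t →
      (b + c₂ * t) ^ 2 / (2 * v t) ≤ Ups b c₁ c₂ v s t := by
    intro s t hs hst
    have vt := hvpos t (hs.trans hst)
    unfold Ups
    split_ifs
    · rw [Lam_eq v s t _ _ vt (Dpos s t hs hst)]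
      have := Dpos s t hs hst
      have : 0 ≤ (Gam v s t * (b + c₂ * t) / v t - c₁ * s) ^ 2 * v t /
        (2 * (v t * v (t - s) - ((v t - v s + v (t - s)) / 2) ^ 2)) := by positivity
      linarith
    · exact le_rfl
  have Ups_nonneg : ∀ s t : ℝ, 0 < s → s < t → 0 ≤ Ups b c₁ c₂ v s t := by
    intro s t hs hst
    have vt := hvpos t (hs.trans hst)
    refine le_trans ?_ (Ups_ge s t hs hst)
    positivity
  have hUs : Ups b c₁ c₂ v sstar tstar = (b + c₂ * tstar) ^ 2 / (2 * v tstar) := by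
    unfold Ups
    rw [if_neg (not_lt.2 hcon.le)]
  have vs := hvpos tstar htsp
  have hLpos : 0 < (b + c₂ * tstar) ^ 2 / (2 * v tstar) := by positivity
  have hbdd : BddAbove ((fun s => Ups b c₁ c₂ v s tstar) '' Ioo (0 : ℝ) tstar) := by
    by_contra hnb
    rw [Real.sSup_of_not_bddAbove hnb] at hsupopt
    rw [hUs] at hsupopt
    linarith
  have hk : ∀ s ∈ Ioo (0 : ℝ) tstar, kvf b c₂ v s tstar ≤ c₁ * s := by
    intro s hs
    by_contra hlt
    push Not at hlt
    have h1 : Ups b c₁ c₂ v s tstar ≤ (b + c₂ * tstar) ^ 2 / (2 * v tstar) := by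
      rw [← hUs, ← hsupopt]
      exact le_csSup hbdd (mem_image_of_mem _ hs)
    unfold Ups at h1
    rw [if_pos hlt, Lam_eq v s tstar _ _ vs (Dpos s tstar hs.1 hs.2)] at h1
    have hd := Dpos s tstar hs.1 hs.2
    unfold kvf at hlt
    have h2 : 0 < Gam v s tstar * (b + c₂ * tstar) / v tstar - c₁ * s := sub_pos.2 hlt
    have : 0 < (Gam v s tstar * (b + c₂ * tstar) / v tstar - c₁ * s) ^ 2 * v tstar /
        (2 * (v tstar * v (tstar - s) - ((v tstar - v s + v (tstar - s)) / 2) ^ 2)) := by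
      positivity
    linarith
  have hne : tstar ≠ tF := by
    rintro rfl
    obtain ⟨s, hs, hlt⟩ := hc1F
    exact absurd (hk s hs) (not_le.2 hlt)
  have hLlt : (b + c₂ * tF) ^ 2 / (2 * v tF) < (b + c₂ * tstar) ^ 2 / (2 * v tstar) := by
    have hm := hminF ((tstar + tF) / 2) (mem_Ioi.2 (by linarith))
    refine hm.trans_lt ?_
    rcases lt_or_gt_of_ne hne with h | h
    · exact hdec (mem_Ioo.2 ⟨htsp, h⟩) (mem_Ioo.2 ⟨by linarith, by linarith⟩) (by linarith)
    · exact hinc (mem_Ioi.2 (by linarith)) (mem_Ioi.2 h) (by linarith)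
  have L_eq : ∀ t : ℝ, 0 < t →
      (b + c₂ * t) ^ 2 / (2 * v t) = ((b + c₂ * t) / Real.sqrt (v t)) ^ 2 / 2 := by
    intro t ht
    rw [div_pow, Real.sq_sqrt (hvpos t ht).le]
    field_simp
  have gs := Real.sqrt_pos.2 vs
  have gF := Real.sqrt_pos.2 (hvpos tF htF0)
  have hqlt : (b + c₂ * tF) / Real.sqrt (v tF) < (b + c₂ * tstar) / Real.sqrt (v tstar) := by
    rw [L_eq _ htF0, L_eq _ htsp] at hLlt
    refine lt_of_pow_lt_pow_left₀ 2 (by positivity) ?_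
    linarith
  obtain ⟨C, hC0, ε, hε, hloc⟩ := local_bound b c₁ c₂ hb hc₂ hc v hv0 hvpos hC2 hmono hconc
    tstar htstar hk
  obtain ⟨m, hm⟩ : ∃ m, m = (b + c₂ * tstar) / Real.sqrt (v tstar) * Real.sqrt (v tF) *
    ((b + c₂ * tstar) / Real.sqrt (v tstar) - (b + c₂ * tF) / Real.sqrt (v tF)) /
      (Real.sqrt (v tstar) + Real.sqrt (v tF)) / 2 := ⟨_, rfl⟩
  have hmp : 0 < m := by
    have := sub_pos.2 hqlt
    rw [hm]; positivity
  have main : ∀ w : ℝ, 0 < w → w ≤ 1 → w * |tF - tstar| < ε →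
      w * m ≤ C * (w * (tF - tstar)) ^ 2 := by
    intro w hw hw1 hwε
    obtain ⟨t, ht⟩ : ∃ t, t = (1 - w) * tstar + w * tF := ⟨_, rfl⟩
    have htt : t - tstar = w * (tF - tstar) := by rw [ht]; ring
    obtain ⟨ht0, hU⟩ := hloc t (by rw [htt, abs_mul, abs_of_pos hw]; exact hwε)
    have htp : 0 < t := ht0p.trans ht0
    have h1 : sSup ((fun s => Ups b c₁ c₂ v s t) '' Ioo (0 : ℝ) t) ≤
        (b + c₂ * t) ^ 2 / (2 * v t) + C * (t - tstar) ^ 2 := by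
      refine csSup_le ((nonempty_Ioo.2 htp).image _) ?_
      rintro _ ⟨s, hs, rfl⟩
      exact hU s hs
    have h2 : (b + c₂ * tstar) ^ 2 / (2 * v tstar) ≤
        sSup ((fun s => Ups b c₁ c₂ v s t) '' Ioo (0 : ℝ) t) := by
      rw [← hUs, ← hinfopt]
      refine csInf_le ⟨0, ?_⟩ ⟨t, ht0, rfl⟩
      rintro _ ⟨u, hu, rfl⟩
      refine Real.sSup_nonneg ?_
      rintro _ ⟨s, hs, rfl⟩
      exact Ups_nonneg s u hs.1 hs.2
    have hcv := hconc.concaveOn.2 (mem_Ici.2 htsp.le) (mem_Ici.2 htF0.le)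
      (sub_nonneg.2 hw1) hw.le (by ring)
    simp only [smul_eq_mul] at hcv
    rw [← ht] at hcv
    have h3 := slope_aux _ _ _ (b + c₂ * t) (b + c₂ * tstar) (b + c₂ * tF) _ _ _ w (by positivity)
      (by positivity) gs gF hw hw1 (by rw [ht]; ring) hcv rfl rfl rfl hqlt
    rw [← hm, ← L_eq t htp, ← L_eq tstar htsp] at h3
    rw [htt] at h1
    linarith
  have hd : 0 < |tF - tstar| := abs_pos.2 (sub_ne_zero.2 hne.symm)
  obtain ⟨d, hde⟩ : ∃ d, d = |tF - tstar| := ⟨_, rfl⟩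
  rw [← hde] at hd main
  obtain ⟨w, hwe⟩ : ∃ w, w = min 1 (min (ε / (2 * d)) (m / (2 * (C * d ^ 2 + 1)))) := ⟨_, rfl⟩
  have hw0 : 0 < w := by
    rw [hwe]
    refine lt_min one_pos (lt_min ?_ ?_) <;> positivity
  have hw1 : w ≤ 1 := by rw [hwe]; exact min_le_left _ _
  have hw2 : w ≤ ε / (2 * d) := by
    rw [hwe]; exact (min_le_right _ _).trans (min_le_left _ _)
  have hw3 : w ≤ m / (2 * (C * d ^ 2 + 1)) := by
    rw [hwe]; exact (min_le_right _ _).trans (min_le_right _ _)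
  rw [le_div_iff₀ (by positivity)] at hw2 hw3
  have h := main w hw0 hw1 (by nlinarith)
  rw [mul_pow, ← sq_abs (tF - tstar), ← hde] at h
  have h' : w * m ≤ w * (w * (C * d ^ 2)) := by linarith
  have h'' := le_of_mul_le_mul_left h' hw0
  nlinarith

end
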